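/- arXiv:0802.1440 — 2 statements merged into one kernel-verified Lean document; each statement's English description precedes it below -/
import Mathlib

section
/- ∑_{n=0}^{∞} ψ(n + 1/2)/(2n+1)^2 = -(1/8)(γ π^2 + 7 ζ(3)). -/
open Real Finset

noncomputable def digamma (x : ℝ) : ℝ := deriv (fun y : ℝ => Real.log (Real.Gamma y)) x

open Filter Topology

theorem hasDerivAt_log_Gamma {x : ℝ} (hx : 0 < x) :
    HasDerivAt (fun y : ℝ => Real.log (Real.Gamma y)) (digamma x) x := by
  have h : DifferentiableAt ℝ (fun y : ℝ => Real.log (Real.Gamma y)) x :=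
    (Real.differentiableAt_Gamma fun m => by
      have : (0 : ℝ) ≤ m := m.cast_nonneg
      linarith).log (Real.Gamma_pos_of_pos hx).ne'
  exact h.hasDerivAt

theorem digamma_add_one {x : ℝ} (hx : 0 < x) : digamma (x + 1) = digamma x + 1 / x := by
  have h1 : HasDerivAt (fun y : ℝ => Real.log (Real.Gamma (y + 1))) (digamma (x + 1)) x :=
    (hasDerivAt_log_Gamma (by positivity : 0 < x + 1)).comp_add_const x 1
  have h2 : HasDerivAt (fun y : ℝ => Real.log (Real.Gamma y) + Real.log y)
      (digamma x + x⁻¹) x := (hasDerivAt_log_Gamma hx).add (Real.hasDerivAt_log hx.ne')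
  rw [one_div]
  refine h1.unique (h2.congr_of_eventuallyEq ?_)
  filter_upwards [eventually_gt_nhds hx] with y hy
  rw [Real.Gamma_add_one hy.ne', Real.log_mul hy.ne' (Real.Gamma_pos_of_pos hy).ne', add_comm]

theorem digamma_one_half :
    digamma (1 / 2) = -2 * Real.log 2 - Real.eulerMascheroniConstant := by
  have hpi : √π ≠ 0 := by positivity
  have h := Real.hasDerivAt_Gamma_one_half.log
    (Real.Gamma_pos_of_pos (by norm_num : (0 : ℝ) < 1 / 2)).ne'
  rw [Real.Gamma_one_half_eq] at h
  rw [digamma, h.deriv]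
  field_simp
  ring

/-- The sum of the reciprocals of the first `n` odd numbers. -/
noncomputable def oddHarmonic (n : ℕ) : ℝ := ∑ k ∈ range n, 1 / (2 * (k : ℝ) + 1)

theorem digamma_nat_add_one_half (n : ℕ) :
    digamma ((n : ℝ) + 1 / 2) =
      2 * oddHarmonic n - 2 * Real.log 2 - Real.eulerMascheroniConstant := by
  induction n with
  | zero =>
    rw [Nat.cast_zero, zero_add, digamma_one_half, oddHarmonic]
    simp
  | succ n ih =>
    rw [show ((n + 1 : ℕ) : ℝ) + 1 / 2 = (n + 1 / 2 : ℝ) + 1 by push_cast; ring,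
      digamma_add_one (by positivity), ih, oddHarmonic, oddHarmonic, sum_range_succ]
    field_simp
    ring

theorem hasSum_sub_shift {u : ℕ → ℝ} (hu : Antitone u) (h0 : Tendsto u atTop (𝓝 0)) (k : ℕ) :
    HasSum (fun j => u j - u (k + j)) (∑ l ∈ range k, u l) := by
  rw [hasSum_iff_tendsto_nat_of_nonneg fun j => sub_nonneg.2 (hu (Nat.le_add_left j k))]
  have key (N : ℕ) : ∑ j ∈ range N, (u j - u (k + j)) =
      ∑ l ∈ range k, u l - ∑ l ∈ range k, u (N + l) := by
    have h1 := sum_range_add u N k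
    have h2 := sum_range_add u k N
    rw [add_comm k N] at h2
    rw [sum_sub_distrib]
    linarith
  simp only [key]
  have h : Tendsto (fun N => ∑ l ∈ range k, u (N + l)) atTop (𝓝 (∑ l ∈ range k, (0 : ℝ))) :=
    tendsto_finsetSum _ fun l _ => (tendsto_add_atTop_iff_nat l).2 h0
  rw [sum_const_zero] at h
  simpa only [sub_zero] using h.const_sub (∑ l ∈ range k, u l)

theorem hasSum_reciprocal_sub_shift (k : ℕ) :
    HasSum (fun j : ℕ => 1 / ((j : ℝ) + 1) - 1 / (((k + j : ℕ) : ℝ) + 1))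
      (∑ l ∈ range k, 1 / ((l : ℝ) + 1)) :=
  hasSum_sub_shift (u := fun j : ℕ => 1 / ((j : ℝ) + 1))
    (fun a b hab => by
      have : (a : ℝ) ≤ b := by exact_mod_cast hab
      dsimp only
      gcongr)
    tendsto_one_div_add_atTop_nhds_zero_nat k

theorem hasSum_odd_reciprocal_sub_shift (k : ℕ) :
    HasSum (fun j : ℕ => 1 / (2 * (j : ℝ) + 1) - 1 / (2 * ((k + j : ℕ) : ℝ) + 1))
      (oddHarmonic k) := by
  refine hasSum_sub_shift (u := fun j : ℕ => 1 / (2 * (j : ℝ) + 1)) (fun a b hab => ?_) ?_ k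
  · have : (a : ℝ) ≤ b := by exact_mod_cast hab
    dsimp only
    gcongr
  · refine squeeze_zero (fun j => by positivity) (fun j => ?_)
      (tendsto_one_div_add_atTop_nhds_zero_nat (𝕜 := ℝ))
    gcongr
    have : (0 : ℝ) ≤ j := j.cast_nonneg
    linarith

theorem hasSum_alternating_harmonic :
    HasSum (fun m : ℕ => 1 / (2 * (m : ℝ) + 1) - 1 / (2 * (m : ℝ) + 2)) (Real.log 2) := by
  rw [hasSum_iff_tendsto_nat_of_nonneg fun m => sub_nonneg.2 (by gcongr; norm_num)]
  have key (M : ℕ) : ∑ m ∈ range M, (1 / (2 * (m : ℝ) + 1) - 1 / (2 * (m : ℝ) + 2)) =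
      (harmonic (2 * M) : ℝ) - harmonic M := by
    induction M with
    | zero => simp
    | succ M ih =>
      rw [sum_range_succ, ih, show 2 * (M + 1) = 2 * M + 1 + 1 by ring, harmonic_succ,
        harmonic_succ, harmonic_succ]
      push_cast
      field_simp
      ring
  simp only [key]
  have h2 : Tendsto (fun M : ℕ => 2 * M) atTop atTop :=
    tendsto_id.const_mul_atTop' two_pos
  have h := ((Real.tendsto_harmonic_sub_log.comp h2).sub Real.tendsto_harmonic_sub_log).add_const
    (Real.log 2)
  rw [sub_self, zero_add] at h
  refine h.congr' ?_
  filter_upwards [eventually_gt_atTop 0] with M hM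
  have : (M : ℝ) ≠ 0 := by positivity
  simp only [Function.comp_apply, Nat.cast_mul, Nat.cast_ofNat, Real.log_mul two_ne_zero this]
  ring

theorem hasSum_antidiagonal {f : ℕ × ℕ → ℝ} (hf : Summable f) :
    HasSum (fun n => ∑ p ∈ antidiagonal n, f p) (∑' p, f p) := by
  have h := (HasAntidiagonal.sigmaAntidiagonalEquivProd (A := ℕ)).hasSum_iff.2 hf.hasSum
  convert h.sigma fun n => hasSum_fintype _ using 2 with n
  exact (sum_coe_sort (antidiagonal n) f).symm

/-- The summand of the Tornheim double series of weight three, with both indices shifted to start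
at zero. -/
noncomputable def tornheim (p : ℕ × ℕ) : ℝ :=
  1 / (((p.1 : ℝ) + 1) * (p.2 + 1) * (p.1 + p.2 + 2))

theorem summable_tornheim : Summable tornheim := by
  have h : Summable fun n : ℕ => 1 / ((n : ℝ) + 1) ^ (3 / 2 : ℝ) := by
    simpa using (summable_nat_add_iff 1).2
      (Real.summable_one_div_nat_rpow.2 (by norm_num : (1 : ℝ) < 3 / 2))
  refine Summable.of_nonneg_of_le (fun p => by unfold tornheim; positivity) (fun p => ?_)
    (h.mul_of_nonneg h (fun n => by positivity) fun n => by positivity)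
  have ha : (0 : ℝ) < (p.1 : ℝ) + 1 := by positivity
  have hb : (0 : ℝ) < (p.2 : ℝ) + 1 := by positivity
  have e : (3 / 2 : ℝ) = 1 + 1 / 2 := by norm_num
  rw [tornheim, div_mul_div_comm, one_mul, e, Real.rpow_add ha, Real.rpow_add hb, Real.rpow_one,
    Real.rpow_one, ← Real.sqrt_eq_rpow, ← Real.sqrt_eq_rpow, mul_mul_mul_comm]
  gcongr
  nlinarith [sq_nonneg (√((p.1 : ℝ) + 1) - √((p.2 : ℝ) + 1)), Real.sq_sqrt ha.le,
    Real.sq_sqrt hb.le, Real.sqrt_nonneg ((p.1 : ℝ) + 1), Real.sqrt_nonneg ((p.2 : ℝ) + 1)]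

theorem hasSum_tornheim_row (i : ℕ) :
    HasSum (fun j => tornheim (i, j))
      ((∑ l ∈ range (i + 1), 1 / ((l : ℝ) + 1)) / ((i : ℝ) + 1) ^ 2) := by
  refine ((hasSum_reciprocal_sub_shift (i + 1)).div_const (((i : ℝ) + 1) ^ 2)).congr_fun ?_
  intro j
  simp only [tornheim]
  push_cast
  have : (i : ℝ) + 1 + j + 1 ≠ 0 := by positivity
  have : (i : ℝ) + j + 2 ≠ 0 := by positivity
  field_simp
  ring

theorem sum_antidiagonal_fst_add_snd (g : ℕ → ℝ) (n : ℕ) :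
    ∑ p ∈ antidiagonal n, (g p.1 + g p.2) = 2 * ∑ l ∈ range (n + 1), g l := by
  have h : ∑ p ∈ antidiagonal n, g p.2 = ∑ p ∈ antidiagonal n, g p.1 :=
    Nat.sum_antidiagonal_swap (f := fun p : ℕ × ℕ => g p.1)
  rw [sum_add_distrib, h, Nat.sum_antidiagonal_eq_sum_range_succ_mk, two_mul]

theorem sum_antidiagonal_tornheim (n : ℕ) :
    ∑ p ∈ antidiagonal n, tornheim p =
      2 * ((∑ l ∈ range (n + 1), 1 / ((l : ℝ) + 1)) / ((n : ℝ) + 2) ^ 2) := by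
  have h : ∀ p ∈ antidiagonal n, tornheim p =
      (1 / ((p.1 : ℝ) + 1) + 1 / ((p.2 : ℝ) + 1)) / ((n : ℝ) + 2) ^ 2 := by
    rintro ⟨i, j⟩ hp
    obtain rfl := mem_antidiagonal.1 hp
    simp only [tornheim]
    push_cast
    field_simp
    ring
  rw [sum_congr rfl h, ← sum_div, sum_antidiagonal_fst_add_snd fun l => 1 / ((l : ℝ) + 1),
    mul_div_assoc]

theorem sum_antidiagonal_tornheim_odd_odd (n : ℕ) :
    ∑ p ∈ antidiagonal n, tornheim (2 * p.1, 2 * p.2) =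
      2 * (oddHarmonic (n + 1) / (2 * (n : ℝ) + 2) ^ 2) := by
  have h : ∀ p ∈ antidiagonal n, tornheim (2 * p.1, 2 * p.2) =
      (1 / (2 * (p.1 : ℝ) + 1) + 1 / (2 * (p.2 : ℝ) + 1)) / (2 * (n : ℝ) + 2) ^ 2 := by
    rintro ⟨i, j⟩ hp
    obtain rfl := mem_antidiagonal.1 hp
    simp only [tornheim]
    push_cast
    field_simp
    ring
  rw [sum_congr rfl h, ← sum_div, sum_antidiagonal_fst_add_snd fun l => 1 / (2 * (l : ℝ) + 1),
    mul_div_assoc, oddHarmonic]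

theorem hasSum_tornheim_odd_even_row (i : ℕ) :
    HasSum (fun j => tornheim (2 * i, 2 * j + 1))
      ((oddHarmonic (i + 1) - Real.log 2) / (2 * (i : ℝ) + 1) ^ 2) := by
  refine (((hasSum_odd_reciprocal_sub_shift (i + 1)).sub
    hasSum_alternating_harmonic).div_const ((2 * (i : ℝ) + 1) ^ 2)).congr_fun ?_
  intro j
  simp only [tornheim]
  push_cast
  have : 2 * ((i : ℝ) + 1 + j) + 1 ≠ 0 := by positivity
  have : 2 * (i : ℝ) + (2 * j + 1) + 2 ≠ 0 := by positivity
  field_simp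
  ring

theorem hasSum_tornheim_odd_even_column (j : ℕ) :
    HasSum (fun i => tornheim (2 * i, 2 * j + 1))
      (oddHarmonic (j + 1) / (2 * (j : ℝ) + 2) ^ 2) := by
  refine ((hasSum_odd_reciprocal_sub_shift (j + 1)).div_const ((2 * (j : ℝ) + 2) ^ 2)).congr_fun ?_
  intro i
  simp only [tornheim]
  push_cast
  have : 2 * ((j : ℝ) + 1 + i) + 1 ≠ 0 := by positivity
  have : 2 * (i : ℝ) + (2 * j + 1) + 2 ≠ 0 := by positivity
  field_simp
  ring

theorem tornheim_swap (p : ℕ × ℕ) : tornheim p.swap = tornheim p := by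
  simp only [tornheim, Prod.fst_swap, Prod.snd_swap, add_comm (p.2 : ℝ) p.1, mul_comm]

theorem hasSum_one_div_add_one_cube :
    HasSum (fun n : ℕ => 1 / ((n : ℝ) + 1) ^ 3) ((∑' p, tornheim p) / 2) := by
  set G : ℕ → ℝ := fun n => (∑ l ∈ range n, 1 / ((l : ℝ) + 1)) / ((n : ℝ) + 1) ^ 2 with hG
  have hrow := summable_tornheim.hasSum.prod_fiberwise hasSum_tornheim_row
  have hdiag : HasSum G ((∑' p, tornheim p) / 2) := by
    have h := (hasSum_antidiagonal summable_tornheim).div_const 2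
    refine (hasSum_nat_add_iff' 1).1 ?_
    rw [sum_range_one, show G 0 = 0 by simp [hG], sub_zero]
    refine h.congr_fun fun n => ?_
    rw [sum_antidiagonal_tornheim, hG]
    push_cast
    ring
  rw [← sub_half]
  refine (hrow.sub hdiag).congr_fun fun n => ?_
  rw [hG, sum_range_succ]
  field_simp
  ring

theorem tsum_prod_even_add_odd {f : ℕ × ℕ → ℝ} (hf : Summable f) :
    ∑' p : ℕ × ℕ, f (2 * p.1, p.2) + ∑' p : ℕ × ℕ, f (2 * p.1 + 1, p.2) = ∑' p, f p := by
  have he : Summable fun p : ℕ × ℕ => f (2 * p.1, p.2) :=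
    hf.comp_injective (i := fun p : ℕ × ℕ => (2 * p.1, p.2)) fun p q h => by
      simp only [Prod.mk.injEq] at h
      exact Prod.ext (by omega) h.2
  have ho : Summable fun p : ℕ × ℕ => f (2 * p.1 + 1, p.2) :=
    hf.comp_injective (i := fun p : ℕ × ℕ => (2 * p.1 + 1, p.2)) fun p q h => by
      simp only [Prod.mk.injEq] at h
      exact Prod.ext (by omega) h.2
  rw [he.tsum_prod, ho.tsum_prod, hf.tsum_prod]
  exact tsum_even_add_odd (f := fun i => ∑' j, f (i, j)) he.prod ho.prod

theorem tsum_prod_even_add_odd_snd {f : ℕ × ℕ → ℝ} (hf : Summable f) :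
    ∑' p : ℕ × ℕ, f (p.1, 2 * p.2) + ∑' p : ℕ × ℕ, f (p.1, 2 * p.2 + 1) = ∑' p, f p := by
  have h := tsum_prod_even_add_odd (f := fun p => f p.swap)
    ((Equiv.prodComm ℕ ℕ).summable_iff.2 hf)
  rw [← (Equiv.prodComm ℕ ℕ).tsum_eq f, ← (Equiv.prodComm ℕ ℕ).tsum_eq,
    ← (Equiv.prodComm ℕ ℕ).tsum_eq fun p : ℕ × ℕ => f (p.1, 2 * p.2 + 1)]
  exact h

theorem summable_tornheim_comp {a b : ℕ → ℕ} (ha : Function.Injective a)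
    (hb : Function.Injective b) : Summable fun p : ℕ × ℕ => tornheim (a p.1, b p.2) :=
  summable_tornheim.comp_injective (ha.prodMap hb)

theorem injective_two_mul : Function.Injective fun n : ℕ => 2 * n := fun a b h => by
  simpa using h

theorem injective_two_mul_add_one : Function.Injective fun n : ℕ => 2 * n + 1 := fun a b h => by
  simpa using h

theorem summable_tornheim_odd_even :
    Summable fun p : ℕ × ℕ => tornheim (2 * p.1, 2 * p.2 + 1) :=
  summable_tornheim_comp (a := fun n => 2 * n) (b := fun n => 2 * n + 1)
    injective_two_mul injective_two_mul_add_one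

theorem tsum_tornheim_odd_odd :
    ∑' p : ℕ × ℕ, tornheim (2 * p.1, 2 * p.2) =
      2 * ∑' p : ℕ × ℕ, tornheim (2 * p.1, 2 * p.2 + 1) := by
  have hdiag := hasSum_antidiagonal (summable_tornheim_comp injective_two_mul injective_two_mul)
  simp only [sum_antidiagonal_tornheim_odd_odd] at hdiag
  have hcol := ((Equiv.prodComm ℕ ℕ).hasSum_iff.2
    summable_tornheim_odd_even.hasSum).prod_fiberwise hasSum_tornheim_odd_even_column
  exact hdiag.unique (hcol.mul_left 2)

theorem tsum_tornheim_odd_even :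
    ∑' p : ℕ × ℕ, tornheim (2 * p.1, 2 * p.2 + 1) = 7 / 32 * ∑' p, tornheim p := by
  have h := tsum_prod_even_add_odd summable_tornheim
  rw [← tsum_prod_even_add_odd_snd (summable_tornheim_comp injective_two_mul fun _ _ h => h),
    ← tsum_prod_even_add_odd_snd
      (summable_tornheim_comp injective_two_mul_add_one fun _ _ h => h),
    tsum_tornheim_odd_odd] at h
  have heo : ∑' p : ℕ × ℕ, tornheim (2 * p.1 + 1, 2 * p.2) =
      ∑' p : ℕ × ℕ, tornheim (2 * p.1, 2 * p.2 + 1) := by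
    rw [← (Equiv.prodComm ℕ ℕ).tsum_eq]
    exact tsum_congr fun p => tornheim_swap (2 * p.1, 2 * p.2 + 1)
  have hee : ∑' p : ℕ × ℕ, tornheim (2 * p.1 + 1, 2 * p.2 + 1) = 1 / 8 * ∑' p, tornheim p := by
    rw [← tsum_mul_left]
    refine tsum_congr fun p => ?_
    simp only [tornheim]
    push_cast
    field_simp
    ring
  linarith

theorem hasSum_one_div_odd_pow {k : ℕ} {s : ℝ}
    (h : HasSum (fun n : ℕ => 1 / ((n : ℝ) + 1) ^ k) s) :
    HasSum (fun n : ℕ => 1 / (2 * (n : ℝ) + 1) ^ k) (s - s / 2 ^ k) := by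
  have ho : HasSum (fun n : ℕ => 1 / (((2 * n + 1 : ℕ) : ℝ) + 1) ^ k) (s / 2 ^ k) := by
    refine (h.div_const (2 ^ k)).congr_fun fun n => ?_
    rw [div_div, ← mul_pow]
    push_cast
    ring
  have he : Summable fun n : ℕ => 1 / (((2 * n : ℕ) : ℝ) + 1) ^ k :=
    h.summable.comp_injective injective_two_mul
  have e := (HasSum.even_add_odd (f := fun n : ℕ => 1 / ((n : ℝ) + 1) ^ k) he.hasSum ho).unique h
  rw [← eq_sub_of_add_eq e]
  simpa using he.hasSum

theorem hasSum_digamma_div_odd_sq :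
    HasSum (fun n : ℕ => digamma ((n : ℝ) + 1 / 2) / (2 * (n : ℝ) + 1) ^ 2)
      (-(1 / 8) * (Real.eulerMascheroniConstant * π ^ 2 + 7 * ((∑' p, tornheim p) / 2))) := by
  have h2 : HasSum (fun n : ℕ => 1 / ((n : ℝ) + 1) ^ 2) (π ^ 2 / 6) := by
    simpa using (hasSum_nat_add_iff' 1).2 hasSum_zeta_two
  have h := (((summable_tornheim_odd_even.hasSum.prod_fiberwise
    hasSum_tornheim_odd_even_row).mul_left 2).sub
      ((hasSum_one_div_odd_pow hasSum_one_div_add_one_cube).mul_left 2)).sub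
        ((hasSum_one_div_odd_pow h2).mul_left Real.eulerMascheroniConstant)
  rw [tsum_tornheim_odd_even] at h
  rw [show -(1 / 8) * (Real.eulerMascheroniConstant * π ^ 2 + 7 * ((∑' p, tornheim p) / 2)) =
    2 * (7 / 32 * ∑' p, tornheim p) -
      2 * ((∑' p, tornheim p) / 2 - (∑' p, tornheim p) / 2 / 2 ^ 3) -
      Real.eulerMascheroniConstant * (π ^ 2 / 6 - π ^ 2 / 6 / 2 ^ 2) by ring]
  refine h.congr_fun fun n => ?_
  rw [digamma_nat_add_one_half, oddHarmonic, oddHarmonic, sum_range_succ]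
  field_simp
  ring

theorem riemannZeta_three_eq : riemannZeta 3 = (((∑' p, tornheim p) / 2 : ℝ) : ℂ) := by
  have h := zeta_nat_eq_tsum_of_gt_one (by norm_num : 1 < 3)
  have h3 : HasSum (fun n : ℕ => 1 / (n : ℝ) ^ 3) ((∑' p, tornheim p) / 2) := by
    refine (hasSum_nat_add_iff' 1).1 ?_
    simpa using hasSum_one_div_add_one_cube
  rw [← h3.tsum_eq, Complex.ofReal_tsum]
  push_cast at h ⊢
  exact h

theorem stmt_7 :
    ((∑' n : ℕ, digamma ((n : ℝ) + 1/2) / (2 * (n : ℝ) + 1) ^ 2 : ℝ) : ℂ) =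
      -(1/8) * ((Real.eulerMascheroniConstant : ℂ) * (Real.pi : ℂ) ^ 2 + 7 * riemannZeta 3) := by
  rw [hasSum_digamma_div_odd_sq.tsum_eq, riemannZeta_three_eq]
  push_cast
  ring
end

section
/- ∫_0^1 x log Γ(x) dx = (1/4) log(2π) - log A, where log A = 1/12 - ζ'(-1) (Glaisher–Kinkelin constant). -/
noncomputable def logA : ℝ := 1/12 - (deriv riemannZeta (-1)).re

open Filter Topology MeasureTheory

/-- `s - 1` times the Euler–Maclaurin error of order three for `x ↦ x ^ (-s)` on `[n + 1, n + 2]`. -/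
noncomputable def zetaEMTerm (n : ℕ) (s : ℂ) : ℂ :=
  (s - 1) * (s / 12 * (((n + 2 : ℕ) : ℂ) ^ (-s - 1) - ((n + 1 : ℕ) : ℂ) ^ (-s - 1)) +
    (((n + 2 : ℕ) : ℂ) ^ (-s) + ((n + 1 : ℕ) : ℂ) ^ (-s)) / 2) +
    (((n + 2 : ℕ) : ℂ) ^ (1 - s) - ((n + 1 : ℕ) : ℂ) ^ (1 - s))

lemma sum_zetaEMTerm (N : ℕ) (s : ℂ) :
    ∑ n ∈ Finset.range N, zetaEMTerm n s =
      (s - 1) * (s / 12 * (((N + 1 : ℕ) : ℂ) ^ (-s - 1) - 1) +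
        (∑ k ∈ Finset.range N, ((k + 1 : ℕ) : ℂ) ^ (-s)) + (((N + 1 : ℕ) : ℂ) ^ (-s) - 1) / 2) +
        (((N + 1 : ℕ) : ℂ) ^ (1 - s) - 1) := by
  induction N with
  | zero => simp
  | succ N ih =>
    rw [Finset.sum_range_succ, Finset.sum_range_succ, ih, zetaEMTerm]
    ring

lemma hasDerivAt_natCast_succ_cpow {n : ℕ} {f : ℂ → ℂ} {f' z : ℂ} (hf : HasDerivAt f f' z) :
    HasDerivAt (fun s => ((n + 1 : ℕ) : ℂ) ^ f s)
      (((n + 1 : ℕ) : ℂ) ^ f z * (Real.log (n + 1 : ℕ) : ℂ) * f') z := by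
  have h := hf.const_cpow (c := ((n + 1 : ℕ) : ℂ)) (Or.inl (Nat.cast_ne_zero.mpr n.succ_ne_zero))
  rwa [← Complex.natCast_log] at h

lemma differentiable_zetaEMTerm (n : ℕ) : Differentiable ℂ (zetaEMTerm n) := by
  have h (m : ℕ) {f : ℂ → ℂ} (hf : Differentiable ℂ f) :
      Differentiable ℂ (fun s => ((m + 1 : ℕ) : ℂ) ^ f s) :=
    fun z => (hasDerivAt_natCast_succ_cpow (hf z).hasDerivAt).differentiableAt
  have h1 := h n (f := fun s => -s - 1) (by fun_prop)
  have h2 := h (n + 1) (f := fun s => -s - 1) (by fun_prop)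
  have h3 := h n (f := fun s => -s) (by fun_prop)
  have h4 := h (n + 1) (f := fun s => -s) (by fun_prop)
  have h5 := h n (f := fun s => 1 - s) (by fun_prop)
  have h6 := h (n + 1) (f := fun s => 1 - s) (by fun_prop)
  unfold zetaEMTerm
  fun_prop

/-- One sixth of the third Bernoulli polynomial, translated by `n`. -/
noncomputable def zetaEMKernel (n : ℝ) (x : ℝ) : ℝ :=
  ((x - n) ^ 3 - 3 / 2 * (x - n) ^ 2 + (x - n) / 2) / 6

lemma hasDerivAt_zetaEM_antideriv (n : ℝ) (s : ℂ) {x : ℝ} (hx : 0 < x) :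
    HasDerivAt (fun x : ℝ => (s - 1) * ((zetaEMKernel n x : ℂ) * (s * (s + 1) * (x : ℂ) ^ (-s - 2)) +
        ((((x - n) ^ 2 - (x - n) + 1 / 6) / 2 : ℝ) : ℂ) * (s * (x : ℂ) ^ (-s - 1)) +
        ((x - n - 1 / 2 : ℝ) : ℂ) * (x : ℂ) ^ (-s)) + (x : ℂ) ^ (1 - s))
      (-((s - 1) * s * (s + 1) * (s + 2)) * (zetaEMKernel n x * (x : ℂ) ^ (-s - 3))) x := by
  have hpow (r : ℂ) : HasDerivAt (fun y : ℝ => (y : ℂ) ^ r) (r * (x : ℂ) ^ (r - 1)) x := by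
    rcases eq_or_ne r 0 with rfl | hr
    · simpa using hasDerivAt_const x (1 : ℂ)
    · exact hasDerivAt_ofReal_cpow_const hx.ne' hr
  have hid := (hasDerivAt_id x).sub_const n
  have k0 : HasDerivAt (zetaEMKernel n) (((x - n) ^ 2 - (x - n) + 1 / 6) / 2) x := by
    have := ((((hid.pow 3).sub ((hid.pow 2).const_mul (3 / 2))).add (hid.div_const 2)).div_const 6)
    exact this.congr_deriv (by simp only [id]; push_cast; ring)
  have k1 : HasDerivAt (fun x : ℝ => ((x - n) ^ 2 - (x - n) + 1 / 6) / 2) (x - n - 1 / 2) x := by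
    have := (((hid.pow 2).sub hid).add_const (1 / 6)).div_const 2
    exact this.congr_deriv (by simp only [id]; push_cast; ring)
  have k2 : HasDerivAt (fun x : ℝ => x - n - 1 / 2) 1 x := hid.sub_const _
  have := (((((k0.ofReal_comp.mul ((hpow (-s - 2)).const_mul (s * (s + 1)))).add
    (k1.ofReal_comp.mul ((hpow (-s - 1)).const_mul s))).add
    (k2.ofReal_comp.mul (hpow (-s)))).const_mul (s - 1)).add (hpow (1 - s)))
  refine this.congr_deriv ?_
  rw [show -s - 2 - 1 = -s - 3 by ring, show -s - 1 - 1 = -s - 2 by ring,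
    show 1 - s - 1 = -s by ring]
  push_cast
  ring

lemma zetaEMTerm_eq_integral (n : ℕ) (s : ℂ) :
    zetaEMTerm n s = ∫ x : ℝ in ((n + 1 : ℕ) : ℝ)..((n + 2 : ℕ) : ℝ),
      -((s - 1) * s * (s + 1) * (s + 2)) * (zetaEMKernel (n + 1 : ℕ) x * (x : ℂ) ^ (-s - 3)) := by
  have hpos : ∀ x ∈ Set.uIcc ((n + 1 : ℕ) : ℝ) ((n + 2 : ℕ) : ℝ), 0 < x := by
    intro x hx
    rw [Set.uIcc_of_le (by norm_num)] at hx
    exact lt_of_lt_of_le (by positivity) hx.1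
  rw [intervalIntegral.integral_eq_sub_of_hasDerivAt
    (fun x hx => hasDerivAt_zetaEM_antideriv (n + 1 : ℕ) s (hpos x hx))]
  · simp only [zetaEMTerm, zetaEMKernel]
    push_cast
    ring
  · apply ContinuousOn.intervalIntegrable
    intro x hx
    have h1 : ContinuousAt (fun x : ℝ => (x : ℂ) ^ (-s - 3)) x :=
      Complex.continuousAt_ofReal_cpow_const _ _ (Or.inr (hpos x hx).ne')
    have h2 : Continuous (zetaEMKernel (n + 1 : ℕ)) := by unfold zetaEMKernel; fun_prop
    exact (continuousAt_const.mul
      ((Complex.continuous_ofReal.comp h2).continuousAt.mul h1)).continuousWithinAt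

/-- A convex region containing `-1` and `2`, on which the Euler–Maclaurin series converges. -/
def zetaEMRegion : Set ℂ := Metric.ball 0 3 ∩ {s | -3 / 2 < s.re}

lemma isOpen_zetaEMRegion : IsOpen zetaEMRegion :=
  Metric.isOpen_ball.inter (isOpen_lt continuous_const Complex.continuous_re)

lemma isPreconnected_zetaEMRegion : IsPreconnected zetaEMRegion :=
  ((convex_ball 0 3).inter (convex_halfSpace_re_gt _)).isPreconnected

lemma norm_zetaEMTerm_le (n : ℕ) {s : ℂ} (hs : s ∈ zetaEMRegion) :
    ‖zetaEMTerm n s‖ ≤ 240 * ((n + 1 : ℕ) : ℝ) ^ (-3 / 2 : ℝ) := by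
  obtain ⟨h1, h2 : -3 / 2 < s.re⟩ := hs
  rw [mem_ball_zero_iff] at h1
  rw [zetaEMTerm_eq_integral]
  refine (intervalIntegral.norm_integral_le_of_norm_le_const
    (C := 240 * ((n + 1 : ℕ) : ℝ) ^ (-3 / 2 : ℝ)) fun x hx => ?_).trans (by push_cast; norm_num)
  rw [Set.uIoc_of_le (by norm_num)] at hx
  obtain ⟨hx1, hx2⟩ := hx
  have hn : (1 : ℝ) ≤ (n + 1 : ℕ) := by exact_mod_cast Nat.succ_pos n
  have hx0 : 0 < x := by linarith
  rw [norm_mul, norm_mul, norm_neg, norm_mul, norm_mul, norm_mul,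
    Complex.norm_cpow_eq_rpow_re_of_pos hx0]
  have a1 : ‖s - 1‖ ≤ 4 := (norm_sub_le _ _).trans (by norm_num; linarith)
  have a2 : ‖s + 1‖ ≤ 4 := (norm_add_le _ _).trans (by norm_num; linarith)
  have a3 : ‖s + 2‖ ≤ 5 := (norm_add_le _ _).trans (by norm_num; linarith)
  have a4 : ‖(zetaEMKernel (n + 1 : ℕ) x : ℂ)‖ ≤ 1 := by
    rw [Complex.norm_real, Real.norm_eq_abs, zetaEMKernel]
    set u := x - (n + 1 : ℕ)
    have u0 : 0 ≤ u := by simp only [u]; linarith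
    have u1 : u ≤ 1 := by simp only [u]; push_cast at hx2 ⊢; linarith
    have v2 : u ^ 2 ≤ 1 := pow_le_one₀ u0 u1
    have v3 : u ^ 3 ≤ 1 := pow_le_one₀ u0 u1
    rw [abs_le]
    constructor <;> linarith [pow_nonneg u0 2, pow_nonneg u0 3]
  have a5 : x ^ (-s - 3).re ≤ ((n + 1 : ℕ) : ℝ) ^ (-3 / 2 : ℝ) := by
    calc x ^ (-s - 3).re ≤ x ^ (-3 / 2 : ℝ) :=
          Real.rpow_le_rpow_of_exponent_le (by linarith) (by simp; linarith)
      _ ≤ _ := Real.rpow_le_rpow_of_nonpos (by linarith) hx1.le (by norm_num)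
  calc _ ≤ 4 * 3 * 4 * 5 * (1 * ((n + 1 : ℕ) : ℝ) ^ (-3 / 2 : ℝ)) := by gcongr
    _ = _ := by ring

lemma summable_zetaEMBound : Summable fun n : ℕ => 240 * ((n + 1 : ℕ) : ℝ) ^ (-3 / 2 : ℝ) :=
  ((summable_nat_add_iff 1).mpr (Real.summable_nat_rpow.mpr (by norm_num))).mul_left _

lemma tendsto_natCast_succ_cpow_zero {s : ℂ} (hs : s.re < 0) :
    Tendsto (fun N : ℕ => ((N + 1 : ℕ) : ℂ) ^ s) atTop (𝓝 0) := by
  rw [tendsto_zero_iff_norm_tendsto_zero]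
  have h := ((tendsto_rpow_neg_atTop (neg_pos.mpr hs)).comp
    tendsto_natCast_atTop_atTop).comp (tendsto_add_atTop_nat 1)
  refine h.congr fun N => ?_
  simp only [Function.comp_apply, neg_neg]
  rw [Complex.norm_natCast_cpow_of_pos N.succ_pos]

lemma riemannZeta₁_eq_of_one_lt_re {s : ℂ} (hs : 1 < s.re) (hU : s ∈ zetaEMRegion) :
    riemannZeta₁ s = (s - 1) * (1 / 2 + s / 12) + 1 + ∑' n, zetaEMTerm n s := by
  have hs1 : s ≠ 1 := by rintro rfl; simp at hs
  have hsum : Summable fun n => zetaEMTerm n s :=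
    summable_zetaEMBound.of_norm_bounded fun n => norm_zetaEMTerm_le n hU
  have hz : Tendsto (fun N => ∑ k ∈ Finset.range N, ((k + 1 : ℕ) : ℂ) ^ (-s)) atTop
      (𝓝 (riemannZeta s)) := by
    rw [zeta_eq_tsum_one_div_nat_add_one_cpow hs]
    have h := ((summable_nat_add_iff 1).mpr
      (Complex.summable_one_div_nat_cpow.mpr hs)).hasSum.tendsto_sum_nat
    simpa [Complex.cpow_neg] using h
  have hlim := (((((tendsto_natCast_succ_cpow_zero (s := -s - 1)
    (by simp; linarith)).sub_const 1).const_mul (s / 12)).add hz).add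
    (((tendsto_natCast_succ_cpow_zero (s := -s) (by simp; linarith)).sub_const 1).div_const
    2)).const_mul (s - 1) |>.add
    ((tendsto_natCast_succ_cpow_zero (s := 1 - s) (by simp; linarith)).sub_const 1)
  have h := tendsto_nhds_unique hsum.hasSum.tendsto_sum_nat
    (hlim.congr fun N => (sum_zetaEMTerm N s).symm)
  have hz1 : riemannZeta₁ s = (s - 1) * riemannZeta s := by
    rw [riemannZeta_eq_inv_sub_mul hs1, mul_inv_cancel_left₀ (sub_ne_zero.mpr hs1)]
  rw [h, hz1]
  ring

lemma riemannZeta₁_eqOn_zetaEMRegion :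
    Set.EqOn riemannZeta₁
      (fun s => (s - 1) * (1 / 2 + s / 12) + 1 + ∑' n, zetaEMTerm n s) zetaEMRegion := by
  have h2 : (2 : ℂ) ∈ zetaEMRegion := ⟨by norm_num, by norm_num⟩
  have hd : DifferentiableOn ℂ (fun s => ∑' n, zetaEMTerm n s) zetaEMRegion :=
    Complex.differentiableOn_tsum_of_summable_norm summable_zetaEMBound
      (fun n => (differentiable_zetaEMTerm n).differentiableOn) isOpen_zetaEMRegion
      fun n s hs => norm_zetaEMTerm_le n hs
  refine AnalyticOnNhd.eqOn_of_preconnected_of_eventuallyEq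
    (differentiable_riemannZeta₁.differentiableOn.analyticOnNhd isOpen_zetaEMRegion)
    (DifferentiableOn.analyticOnNhd (.add (by fun_prop) hd) isOpen_zetaEMRegion)
    isPreconnected_zetaEMRegion h2 ?_
  filter_upwards [isOpen_zetaEMRegion.mem_nhds h2,
    (isOpen_lt continuous_const Complex.continuous_re).mem_nhds
      (show (2 : ℂ) ∈ {s : ℂ | 1 < s.re} by simp)] with s hs hs'
  exact riemannZeta₁_eq_of_one_lt_re hs' hs

lemma deriv_riemannZeta₁_neg_one :
    deriv riemannZeta₁ (-1) = -1 / 12 - 2 * deriv riemannZeta (-1) := by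
  have hne : (-1 : ℂ) ≠ 1 := by norm_num
  have he : riemannZeta₁ =ᶠ[𝓝 (-1)] fun s => (s - 1) * riemannZeta s := by
    filter_upwards [isOpen_ne.mem_nhds hne] with s hs
    rw [riemannZeta_eq_inv_sub_mul hs, mul_inv_cancel_left₀ (sub_ne_zero.mpr hs)]
  have hv : riemannZeta (-1) = -1 / 12 := by
    have := riemannZeta_neg_nat_eq_bernoulli 1
    norm_num [bernoulli_eq_bernoulli'_of_ne_one, bernoulli'_two] at this
    rw [this]; norm_num
  have hd : HasDerivAt (fun s => (s - 1) * riemannZeta s) _ (-1) :=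
    ((hasDerivAt_id (-1 : ℂ)).sub_const 1).mul (differentiableAt_riemannZeta hne).hasDerivAt
  rw [he.deriv_eq, hd.deriv, hv]
  simp only [id]
  ring

lemma hasSum_deriv_zetaEMTerm :
    HasSum (fun n => deriv (zetaEMTerm n) (-1)) (-1 / 3 - 2 * deriv riemannZeta (-1)) := by
  have hm : (-1 : ℂ) ∈ zetaEMRegion := ⟨by simp, by simp; norm_num⟩
  have h := Complex.hasSum_deriv_of_summable_norm summable_zetaEMBound
      (fun n => (differentiable_zetaEMTerm n).differentiableOn) isOpen_zetaEMRegion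
      (fun n s hs => norm_zetaEMTerm_le n hs) hm
  have hd : DifferentiableAt ℂ (fun s => ∑' n, zetaEMTerm n s) (-1) :=
    (Complex.differentiableOn_tsum_of_summable_norm summable_zetaEMBound
      (fun n => (differentiable_zetaEMTerm n).differentiableOn) isOpen_zetaEMRegion
      fun n s hs => norm_zetaEMTerm_le n hs).differentiableAt (isOpen_zetaEMRegion.mem_nhds hm)
  have he : riemannZeta₁ =ᶠ[𝓝 (-1)] _ :=
    riemannZeta₁_eqOn_zetaEMRegion.eventuallyEq_of_mem (isOpen_zetaEMRegion.mem_nhds hm)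
  have hd' := he.deriv_eq
  have hr : HasDerivAt
      (fun s : ℂ => (s - 1) * (1 / 2 + s / 12) + 1 + ∑' n, zetaEMTerm n s) _ (-1) :=
    ((((hasDerivAt_id (-1 : ℂ)).sub_const 1).mul
      (((hasDerivAt_id (-1 : ℂ)).div_const 12).const_add (1 / 2))).add_const 1).add hd.hasDerivAt
  rw [deriv_riemannZeta₁_neg_one, hr.deriv] at hd'
  have hv : -1 / 3 - 2 * deriv riemannZeta (-1) =
      deriv (fun w => ∑' n, zetaEMTerm n w) (-1) := by
    simp only [id] at hd'
    linear_combination hd'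
  rwa [hv]

lemma sum_deriv_zetaEMTerm (N : ℕ) :
    ∑ n ∈ Finset.range N, deriv (zetaEMTerm n) (-1) =
      ((2 * (∑ k ∈ Finset.range (N + 1), ((k + 1 : ℕ) : ℝ) * Real.log (k + 1 : ℕ))
        - (((N + 1 : ℕ) : ℝ) ^ 2 + (N + 1 : ℕ) + 1 / 6) * Real.log (N + 1 : ℕ)
        + (((N + 1 : ℕ) : ℝ) ^ 2 - 1) / 2 : ℝ) : ℂ) := by
  have hL : HasDerivAt (fun s => ∑ n ∈ Finset.range N, zetaEMTerm n s)
      (∑ n ∈ Finset.range N, deriv (zetaEMTerm n) (-1)) (-1) :=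
    HasDerivAt.fun_sum fun n _ => (differentiable_zetaEMTerm n _).hasDerivAt
  rw [funext fun s => sum_zetaEMTerm N s] at hL
  have hid := hasDerivAt_id (-1 : ℂ)
  have hS : HasDerivAt (fun s : ℂ => ∑ k ∈ Finset.range N, ((k + 1 : ℕ) : ℂ) ^ (-s)) _ (-1) :=
    HasDerivAt.fun_sum fun k _ => hasDerivAt_natCast_succ_cpow hid.neg
  have hR := (((hid.div_const 12).mul
    ((hasDerivAt_natCast_succ_cpow (n := N) (hid.neg.sub_const 1)).sub_const 1)).add hS).add
    (((hasDerivAt_natCast_succ_cpow (n := N) hid.neg).sub_const 1).div_const 2)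
  have hR' := ((hid.sub_const 1).mul hR).add
    ((hasDerivAt_natCast_succ_cpow (n := N) (hid.const_sub 1)).sub_const 1)
  have hsum : ∑ k ∈ Finset.range N, ((k : ℂ) + 1) = N * (N + 1) / 2 := by
    clear hL hS hR hR'
    induction N with
    | zero => simp
    | succ N ih =>
      rw [Finset.sum_range_succ, ih]
      push_cast
      ring
  rw [hL.unique hR', Finset.sum_range_succ]
  norm_num [hsum, Finset.sum_neg_distrib]
  ring

lemma tendsto_sum_mul_log_sub :
    Tendsto (fun n : ℕ => (∑ k ∈ Finset.range n, ((k + 1 : ℕ) : ℝ) * Real.log (k + 1 : ℕ))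
      - ((n : ℝ) ^ 2 / 2 + n / 2 + 1 / 12) * Real.log n + (n : ℝ) ^ 2 / 4) atTop (𝓝 logA) := by
  have h := hasSum_deriv_zetaEMTerm.tendsto_sum_nat
  simp only [sum_deriv_zetaEMTerm] at h
  have h2 := (((Complex.continuous_re.tendsto _).comp h).add_const (1 / 2)).div_const 2
  rw [← tendsto_add_atTop_iff_nat 1]
  convert h2 using 2
  · simp only [Function.comp_apply, Complex.ofReal_re]
    ring
  · simp [logA]
    ring

lemma intervalIntegrable_mul_log_add_natCast (m : ℕ) :
    IntervalIntegrable (fun x : ℝ => x * Real.log (x + m)) volume 0 1 := by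
  have h : IntervalIntegrable Real.log volume (0 + (m : ℝ)) (1 + m) :=
    intervalIntegral.intervalIntegrable_log'
  have := h.comp_add_right (m : ℝ)
  simp only [add_sub_cancel_right] at this
  exact this.continuousOn_mul continuousOn_id

lemma integral_mul_log_add_natCast (m : ℕ) :
    ∫ x in (0 : ℝ)..1, x * Real.log (x + m) =
      (1 - (m : ℝ) ^ 2) / 2 * Real.log (m + 1) + (m : ℝ) ^ 2 / 2 * Real.log m + m / 2 - 1 / 4 := by
  have hc : Continuous fun x : ℝ => (x + m) * Real.log (x + m) :=
    Real.continuous_mul_log.comp (continuous_id.add continuous_const)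
  rw [intervalIntegral.integral_eq_sub_of_hasDerivAt_of_le zero_le_one
    (f := fun x : ℝ => (x + m) * ((x + m) * Real.log (x + m)) / 2 - (x + m) ^ 2 / 4
      - m * ((x + m) * Real.log (x + m)) + m * (x + m)) (by fun_prop) ?_
    (intervalIntegrable_mul_log_add_natCast m)]
  · simp only [zero_add, add_comm (1 : ℝ)]
    ring
  · intro x hx
    have hpos : 0 < x + m := add_pos_of_pos_of_nonneg hx.1 m.cast_nonneg
    have hid := (hasDerivAt_id x).add_const (m : ℝ)
    have hl := hid.mul (hid.log hpos.ne')
    have := ((((hid.mul hl).div_const 2).sub ((hid.pow 2).div_const 4)).sub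
      (hl.const_mul (m : ℝ))).add (hid.const_mul (m : ℝ))
    refine this.congr_deriv ?_
    simp only [id, Pi.mul_apply]
    field_simp
    push_cast
    ring

lemma sum_integral_mul_log_add_natCast (n : ℕ) :
    ∑ m ∈ Finset.range (n + 1), ∫ x in (0 : ℝ)..1, x * Real.log (x + m) =
      (∑ k ∈ Finset.range n, ((k + 1 : ℕ) : ℝ) * Real.log (k + 1 : ℕ))
        + (1 - (n : ℝ) ^ 2) / 2 * Real.log (n + 1) + ((n : ℝ) ^ 2 - 1) / 4 := by
  induction n with
  | zero => rw [Finset.sum_range_one, integral_mul_log_add_natCast]; norm_num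
  | succ n ih =>
    rw [Finset.sum_range_succ, ih, Finset.sum_range_succ, integral_mul_log_add_natCast]
    push_cast
    ring

lemma mul_logGammaSeq_eq (n : ℕ) (x : ℝ) :
    x * Real.BohrMollerup.logGammaSeq x n =
      (x ^ 2 * Real.log n + x * Real.log n.factorial)
        - ∑ m ∈ Finset.range (n + 1), x * Real.log (x + m) := by
  rw [Real.BohrMollerup.logGammaSeq, ← Finset.mul_sum]
  ring

lemma intervalIntegrable_sum_mul_log_add_natCast (n : ℕ) :
    IntervalIntegrable (fun x : ℝ => ∑ m ∈ Finset.range n, x * Real.log (x + m)) volume 0 1 := by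
  simpa only [Finset.sum_fn] using IntervalIntegrable.sum (Finset.range n)
    fun m _ => intervalIntegrable_mul_log_add_natCast m

lemma intervalIntegrable_mul_logGammaSeq (n : ℕ) :
    IntervalIntegrable (fun x => x * Real.BohrMollerup.logGammaSeq x n) volume 0 1 := by
  simp only [mul_logGammaSeq_eq]
  exact (Continuous.intervalIntegrable (by fun_prop) _ _).sub
    (intervalIntegrable_sum_mul_log_add_natCast _)

lemma integral_mul_logGammaSeq (n : ℕ) :
    ∫ x in (0 : ℝ)..1, x * Real.BohrMollerup.logGammaSeq x n =
      1 / 3 * Real.log n + 1 / 2 * Real.log n.factorial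
        - ((∑ k ∈ Finset.range n, ((k + 1 : ℕ) : ℝ) * Real.log (k + 1 : ℕ))
        + (1 - (n : ℝ) ^ 2) / 2 * Real.log (n + 1) + ((n : ℝ) ^ 2 - 1) / 4) := by
  simp only [mul_logGammaSeq_eq]
  rw [intervalIntegral.integral_sub (Continuous.intervalIntegrable (by fun_prop) _ _)
    (intervalIntegrable_sum_mul_log_add_natCast _),
    intervalIntegral.integral_finsetSum fun m _ => intervalIntegrable_mul_log_add_natCast m,
    sum_integral_mul_log_add_natCast, intervalIntegral.integral_add
    (Continuous.intervalIntegrable (by fun_prop) _ _)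
    (Continuous.intervalIntegrable (by fun_prop) _ _)]
  simp
  norm_num

lemma log_Gamma_add_one {y : ℝ} (hy : 0 < y) :
    (Real.log ∘ Real.Gamma) (y + 1) = (Real.log ∘ Real.Gamma) y + Real.log y := by
  simp only [Function.comp_apply]
  rw [Real.Gamma_add_one hy.ne', Real.log_mul hy.ne' (Real.Gamma_pos_of_pos hy).ne', add_comm]

lemma intervalIntegrable_mul_log_Gamma :
    IntervalIntegrable (fun x => x * Real.log (Real.Gamma x)) volume 0 1 := by
  have hc : ContinuousOn (fun x => x * Real.log (Real.Gamma (x + 1)) - x * Real.log x)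
      (Set.uIcc 0 1) := by
    refine ContinuousOn.sub (continuousOn_id.mul fun x hx => ?_) Real.continuous_mul_log.continuousOn
    rw [Set.uIcc_of_le zero_le_one] at hx
    have hx1 : 0 < x + 1 := by linarith [hx.1]
    have hg : ContinuousAt Real.Gamma (x + 1) :=
      (Real.differentiableAt_Gamma fun m => by linarith [m.cast_nonneg (α := ℝ)]).continuousAt
    exact ((hg.comp (f := fun x => x + 1) (by fun_prop)).log
      (Real.Gamma_pos_of_pos hx1).ne').continuousWithinAt
  refine hc.intervalIntegrable.congr fun x hx => ?_
  rw [Set.uIoc_of_le zero_le_one] at hx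
  have := log_Gamma_add_one hx.1
  simp only [Function.comp_apply] at this
  rw [this]
  ring

lemma tendsto_integral_mul_logGammaSeq :
    Tendsto (fun n : ℕ => ∫ x in (0 : ℝ)..1, x * Real.BohrMollerup.logGammaSeq x n) atTop
      (𝓝 (∫ x in (0 : ℝ)..1, x * Real.log (Real.Gamma x))) := by
  rw [tendsto_iff_norm_sub_tendsto_zero]
  refine squeeze_zero' (Eventually.of_forall fun n => norm_nonneg _) ?_
    Real.tendsto_log_nat_add_one_sub_log
  filter_upwards [eventually_ne_atTop 0] with n hn
  rw [← intervalIntegral.integral_sub (intervalIntegrable_mul_logGammaSeq n)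
    intervalIntegrable_mul_log_Gamma]
  refine (intervalIntegral.norm_integral_le_of_norm_le_const
    (C := Real.log (n + 1) - Real.log n) fun x hx => ?_).trans (by simp)
  rw [Set.uIoc_of_le zero_le_one] at hx
  have h1 := Real.BohrMollerup.le_logGammaSeq Real.convexOn_log_Gamma log_Gamma_add_one
    hx.1 hx.2 n
  have h2 := Real.BohrMollerup.ge_logGammaSeq Real.convexOn_log_Gamma log_Gamma_add_one hx.1 hn
  simp only [Function.comp_apply, Real.Gamma_one, Real.log_one, zero_add] at h1 h2
  set d := Real.log (n + 1) - Real.log n with hd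
  have hd0 : 0 ≤ d := sub_nonneg.mpr (Real.log_le_log (by positivity) (by linarith))
  have h3 : x * d ≤ d := mul_le_of_le_one_left hd0 hx.2
  have h4 : |Real.BohrMollerup.logGammaSeq x n - Real.log (Real.Gamma x)| ≤ d := by
    rw [abs_le]
    constructor <;> linarith
  rw [← mul_sub, norm_mul, Real.norm_eq_abs, Real.norm_eq_abs, abs_of_pos hx.1]
  exact (mul_le_of_le_one_left (abs_nonneg _) hx.2).trans h4

lemma tendsto_sq_sub_one_mul_log_one_add_inv :
    Tendsto (fun n : ℕ => ((n : ℝ) ^ 2 - 1) / 2 * (Real.log (n + 1) - Real.log n) - n / 2) atTop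
      (𝓝 (-1 / 4)) := by
  have hmain : Tendsto (fun n : ℕ => (n : ℝ) ^ 2 *
      (Real.log (n + 1) - Real.log n - 1 / n + 1 / (2 * (n : ℝ) ^ 2))) atTop (𝓝 0) := by
    refine squeeze_zero_norm' (a := fun n : ℕ => 2 * (1 / (n : ℝ))) ?_ (by
      simpa using tendsto_one_div_atTop_nhds_zero_nat.const_mul (2 : ℝ))
    filter_upwards [eventually_ge_atTop 2] with n hn
    have hn2 : (2 : ℝ) ≤ n := by exact_mod_cast hn
    have hn0 : (0 : ℝ) < n := by linarith
    have hi : 1 / (n : ℝ) ≤ 1 / 2 := one_div_le_one_div_of_le two_pos hn2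
    have habs : |-(1 / (n : ℝ))| = 1 / n := by rw [abs_neg, abs_of_pos (by positivity)]
    have h := Real.abs_log_sub_add_sum_range_le (x := -(1 / (n : ℝ)))
      (by rw [habs]; linarith) 2
    have hlog : Real.log (1 - -(1 / (n : ℝ))) = Real.log (n + 1) - Real.log n := by
      rw [← Real.log_div (by positivity) hn0.ne']
      congr 1
      field_simp
      ring
    rw [habs, hlog, Finset.sum_range_succ, Finset.sum_range_one] at h
    rw [norm_mul, Real.norm_eq_abs, Real.norm_eq_abs, abs_of_pos (by positivity : (0 : ℝ) < (n : ℝ) ^ 2)]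
    calc (n : ℝ) ^ 2 * |Real.log (n + 1) - Real.log n - 1 / n + 1 / (2 * (n : ℝ) ^ 2)|
        ≤ (n : ℝ) ^ 2 * ((1 / (n : ℝ)) ^ 3 / (1 / 2)) := by
          gcongr
          refine (le_of_eq ?_).trans (h.trans (by gcongr; linarith))
          congr 1
          push_cast
          field_simp
          ring
      _ = 2 * (1 / (n : ℝ)) := by field_simp
  have := ((hmain.div_const 2).sub (Real.tendsto_log_nat_add_one_sub_log.div_const 2)).sub_const
    (1 / 4)
  norm_num at this
  norm_num
  refine this.congr' ?_
  filter_upwards [eventually_ne_atTop 0] with n hn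
  have : (n : ℝ) ≠ 0 := by exact_mod_cast hn
  field_simp
  ring

lemma tendsto_log_factorial_sub :
    Tendsto (fun n : ℕ => Real.log n.factorial - ((n + 1 / 2) * Real.log n - n)) atTop
      (𝓝 (1 / 2 * Real.log (2 * Real.pi))) := by
  have h := ((Real.continuousAt_log (by positivity)).tendsto.comp
    Stirling.tendsto_stirlingSeq_sqrt_pi).add_const (1 / 2 * Real.log 2)
  have hv : Real.log √Real.pi + 1 / 2 * Real.log 2 = 1 / 2 * Real.log (2 * Real.pi) := by
    rw [Real.log_sqrt Real.pi_pos.le, Real.log_mul two_ne_zero Real.pi_ne_zero]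
    ring
  rw [hv] at h
  refine h.congr' ?_
  filter_upwards [eventually_ne_atTop 0] with n hn
  have hn0 : (n : ℝ) ≠ 0 := by exact_mod_cast hn
  simp only [Function.comp_apply]
  rw [Stirling.log_stirlingSeq_formula, Real.log_mul two_ne_zero hn0,
    Real.log_div hn0 (Real.exp_ne_zero _), Real.log_exp]
  ring

theorem stmt_16 :
    ∫ x in (0:ℝ)..1, x * Real.log (Real.Gamma x) =
      (1/4) * Real.log (2 * Real.pi) - logA := by
  refine tendsto_nhds_unique tendsto_integral_mul_logGammaSeq ?_
  have h := (((tendsto_log_factorial_sub.const_mul (1 / 2)).sub tendsto_sum_mul_log_sub).add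
    tendsto_sq_sub_one_mul_log_one_add_inv).add_const (1 / 4)
  convert h using 2
  · rw [integral_mul_logGammaSeq]
    ring
  · ring
end
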